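/- arXiv:1907.13023 — 2 statements merged into one kernel-verified Lean document; each statement's English description precedes it below -/
import Mathlib

section
/- Assume ν ∈ (0,1], H = (6/(3+ν))·H_{f,3}(ν), and that Ω := Ω_{x,3,H}^{(ν)} attains its global minimum on E. Let {y_k} be generated by Algorithm 1 with parameter L₀ > 0, set M_H = max{2L₀, 4L_H}, D_{x,H} = max{1, (6‖∇f(x)‖/H)^{1/2}, 3‖∇²f(x)‖/H, (3 + ‖D³f(x)‖/H)^{1/ν}} and N̂_{x,H} = ‖∇²f(x)‖ + (2+ν)·D_{x,H}². Let ε ∈ (0,1) and T = 3s for some integer s ≥ 1. If ‖∇Ω(y_k)‖ > ε for k = 0, 1, …, T, then T ≤ 3·[M_H·N̂_{x,H}]^{(3+ν)/2}·[(3+ν)·2^{2+ν}·N̂_{x,H}²]^{1/2}·ε^{−(3+ν)/2}. -/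
open scoped InnerProductSpace

/-- The Bregman distance `β_d(u, v) = d(v) − d(u) − ⟨∇d(u), v − u⟩`. -/
noncomputable def breg {E : Type*} [NormedAddCommGroup E] [InnerProductSpace ℝ E]
    [CompleteSpace E] (d : E → ℝ) (u v : E) : ℝ :=
  d v - d u - ⟪gradient d u, v - u⟫_ℝ

/-- One successful step of the adaptive Bregman proximal gradient method with coefficient `M`:
`w` is a global minimizer of `z ↦ ⟨∇g(yk), z − yk⟩ + M·β_d(yk, z)` and satisfies the
sufficient-decrease acceptance test. -/
noncomputable def stepOK {E : Type*} [NormedAddCommGroup E] [InnerProductSpace ℝ E]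
    [CompleteSpace E] (g d : E → ℝ) (M : ℝ) (yk w : E) : Prop :=
  (∀ z : E, ⟪gradient g yk, w - yk⟫_ℝ + M * breg d yk w
      ≤ ⟪gradient g yk, z - yk⟫_ℝ + M * breg d yk z) ∧
  g w ≤ g yk + ⟪gradient g yk, w - yk⟫_ℝ + M * breg d yk w

/-- Algorithm A (adaptive Bregman proximal gradient method): `L 0 = L₀` and, for each `k`,
`i k` is the smallest integer `≥ 0` such that the regularized step with coefficient
`2^{i k}·L k` exists and is accepted, `y (k+1)` is that step, and `L (k+1) = 2^{i k − 1}·L k`. -/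
noncomputable def algA {E : Type*} [NormedAddCommGroup E] [InnerProductSpace ℝ E]
    [CompleteSpace E] (g d : E → ℝ) (L0 : ℝ) (y : ℕ → E) (L : ℕ → ℝ) (i : ℕ → ℕ) : Prop :=
  L 0 = L0 ∧ ∀ k : ℕ,
    stepOK g d ((2 : ℝ) ^ i k * L k) (y k) (y (k + 1)) ∧
    (∀ j : ℕ, j < i k → ¬ ∃ w : E, stepOK g d ((2 : ℝ) ^ j * L k) (y k) w) ∧
    L (k + 1) = (2 : ℝ) ^ i k * L k / 2

section Line

variable {E F : Type*} [NormedAddCommGroup E] [NormedSpace ℝ E] [NormedAddCommGroup F]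
  [NormedSpace ℝ F]

theorem hasDerivAt_add_smul (u d : E) (t : ℝ) : HasDerivAt (fun s : ℝ => u + s • d) d t := by
  simpa using ((hasDerivAt_id t).smul_const d).const_add u

theorem HasFDerivAt.hasDerivAt_add_smul {φ : E → F} {φ' : E →L[ℝ] F} {u d : E} {t : ℝ}
    (hφ : HasFDerivAt φ φ' (u + t • d)) : HasDerivAt (fun s : ℝ => φ (u + s • d)) (φ' d) t :=
  hφ.comp_hasDerivAt t (_root_.hasDerivAt_add_smul u d t)

theorem ContinuousLinearMap.hasDerivAt_add_smul (T : E →L[ℝ] F) (u d : E) (t : ℝ) :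
    HasDerivAt (fun s : ℝ => T (u + s • d)) (T d) t :=
  T.hasFDerivAt.hasDerivAt_add_smul

theorem HasDerivAt.clm_apply_const {f : ℝ → E →L[ℝ] F} {f' : E →L[ℝ] F} {t : ℝ}
    (hf : HasDerivAt f f' t) (v : E) : HasDerivAt (fun s => f s v) (f' v) t := by
  simpa using hf.clm_apply (hasDerivAt_const t v)

end Line

section RegularizedModel

variable {E : Type*} [NormedAddCommGroup E] [InnerProductSpace ℝ E]

/-- The cubic polynomial with coefficients `a`, `ℓ`, `A`, `T`, regularized by the power
`b / (3 + ν) * ‖h‖ ^ (3 + ν)` of the norm. -/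
noncomputable def regModel (a : ℝ) (ℓ : E →L[ℝ] ℝ) (A : E →L[ℝ] E →L[ℝ] ℝ)
    (T : E →L[ℝ] E →L[ℝ] E →L[ℝ] ℝ) (b ν : ℝ) (h : E) : ℝ :=
  a + ℓ h + 1 / 2 * A h h + 1 / 6 * T h h h + b / (3 + ν) * ‖h‖ ^ (3 + ν)

/-- The derivative of `regModel`. -/
noncomputable def regModelDeriv (ℓ : E →L[ℝ] ℝ) (A : E →L[ℝ] E →L[ℝ] ℝ)
    (T : E →L[ℝ] E →L[ℝ] E →L[ℝ] ℝ) (b ν : ℝ) (h : E) : E →L[ℝ] ℝ :=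
  ℓ + A h + (1 / 2 : ℝ) • T h h + (b * ‖h‖ ^ (1 + ν)) • innerSL ℝ h

/-- The Hessian of `‖h‖ ^ (3 + ν) / (3 + ν)` as a bilinear form. -/
noncomputable def normPowHess (ν : ℝ) (h d e : E) : ℝ :=
  (1 + ν) * ‖h‖ ^ (ν - 1) * ⟪h, d⟫_ℝ * ⟪h, e⟫_ℝ + ‖h‖ ^ (1 + ν) * ⟪d, e⟫_ℝ

variable {a b ν : ℝ} {ℓ : E →L[ℝ] ℝ} {A : E →L[ℝ] E →L[ℝ] ℝ}
  {T : E →L[ℝ] E →L[ℝ] E →L[ℝ] ℝ}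

theorem normPowHess_self_ge (hν : 0 < ν) (h d : E) :
    ‖h‖ ^ (1 + ν) * ‖d‖ ^ 2 ≤ normPowHess ν h d d := by
  have h1 : 0 ≤ (1 + ν) * ‖h‖ ^ (ν - 1) := by positivity
  have h2 := mul_nonneg h1 (mul_self_nonneg ⟪h, d⟫_ℝ)
  rw [normPowHess, real_inner_self_eq_norm_sq]
  linarith

theorem normPowHess_abs_le (hν : 0 < ν) (h d e : E) :
    |normPowHess ν h d e| ≤ (2 + ν) * ‖h‖ ^ (1 + ν) * (‖d‖ * ‖e‖) := by
  have h1 : 0 ≤ (1 + ν) * ‖h‖ ^ (ν - 1) := by positivity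
  have hd := abs_real_inner_le_norm h d
  have he := abs_real_inner_le_norm h e
  have hde := abs_real_inner_le_norm d e
  have hpow : ‖h‖ ^ (ν - 1) * (‖h‖ * ‖h‖) = ‖h‖ ^ (1 + ν) := by
    rcases eq_or_ne ‖h‖ 0 with h0 | h0
    · rw [h0, Real.zero_rpow (by linarith : 1 + ν ≠ 0)]; ring
    · have hpos : 0 < ‖h‖ := lt_of_le_of_ne (norm_nonneg _) (Ne.symm h0)
      rw [← sq, ← Real.rpow_natCast, ← Real.rpow_add hpos]
      congr 1; push_cast; ring
  rw [normPowHess]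
  calc _ ≤ |(1 + ν) * ‖h‖ ^ (ν - 1) * ⟪h, d⟫_ℝ * ⟪h, e⟫_ℝ| + |‖h‖ ^ (1 + ν) * ⟪d, e⟫_ℝ| :=
        abs_add_le _ _
    _ = (1 + ν) * ‖h‖ ^ (ν - 1) * (|⟪h, d⟫_ℝ| * |⟪h, e⟫_ℝ|) + ‖h‖ ^ (1 + ν) * |⟪d, e⟫_ℝ| := by
        rw [mul_assoc, abs_mul (_ * _), abs_mul ⟪h, d⟫_ℝ, abs_mul (_ ^ _), abs_of_nonneg h1,
          abs_of_nonneg (by positivity : 0 ≤ ‖h‖ ^ (1 + ν))]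
    _ ≤ (1 + ν) * ‖h‖ ^ (ν - 1) * ((‖h‖ * ‖d‖) * (‖h‖ * ‖e‖)) + ‖h‖ ^ (1 + ν) * (‖d‖ * ‖e‖) := by
        gcongr
    _ = (1 + ν) * (‖h‖ ^ (ν - 1) * (‖h‖ * ‖h‖)) * (‖d‖ * ‖e‖) + ‖h‖ ^ (1 + ν) * (‖d‖ * ‖e‖) := by
        ring
    _ = _ := by rw [hpow]; ring

theorem hasFDerivAt_regModel (hν : 0 < ν) (hA : ∀ u v, A u v = A v u)
    (hT₁ : ∀ u v w, T u v w = T v u w) (hT₂ : ∀ u v w, T u v w = T u w v) (h : E) :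
    HasFDerivAt (regModel a ℓ A T b ν) (regModelDeriv ℓ A T b ν h) h := by
  have hid := hasFDerivAt_id (𝕜 := ℝ) h
  have h2 := (A.hasFDerivAt (x := h)).clm_apply hid
  have h3 := ((T.hasFDerivAt (x := h)).clm_apply hid).clm_apply hid
  have h4 := hasFDerivAt_norm_rpow h (by linarith : 1 < 3 + ν)
  have := ((((ℓ.hasFDerivAt (x := h)).const_add a).add (h2.const_mul (1 / 2))).add
    (h3.const_mul (1 / 6))).add (h4.const_mul (b / (3 + ν)))
  refine this.congr_fderiv ?_
  ext d
  have e : (3 : ℝ) + ν - 2 = 1 + ν := by ring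
  have hne : (3 : ℝ) + ν ≠ 0 := by positivity
  simp only [regModelDeriv, add_apply, smul_apply,
    ContinuousLinearMap.comp_apply, ContinuousLinearMap.flip_apply, ContinuousLinearMap.id_apply,
    smul_eq_mul, e, id, innerSL_apply_apply]
  rw [hA d h, hT₁ d h h, hT₂ h d h]
  field_simp
  ring

theorem hasDerivAt_regModelDeriv_line (hν : 0 < ν) (hT₁ : ∀ u v w, T u v w = T v u w)
    (u d e : E) (t : ℝ) :
    HasDerivAt (fun s : ℝ => regModelDeriv ℓ A T b ν (u + s • d) e)
      (A d e + T (u + t • d) d e + b * normPowHess ν (u + t • d) d e) t := by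
  have hl := hasDerivAt_add_smul u d t
  have h2 : HasDerivAt (fun s : ℝ => A (u + s • d) e) (A d e) t :=
    (A.flip e).hasDerivAt_add_smul u d t
  have h3 : HasDerivAt (fun s : ℝ => T (u + s • d) (u + s • d) e)
      (T d (u + t • d) e + T (u + t • d) d e) t := by
    have hT : HasDerivAt (fun s : ℝ => T (u + s • d)) (T d) t :=
      ContinuousLinearMap.hasDerivAt_add_smul (F := E →L[ℝ] E →L[ℝ] ℝ) T u d t
    have hT' : HasDerivAt (fun s : ℝ => T (u + s • d) (u + s • d))
        (T d (u + t • d) + T (u + t • d) d) t :=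
      HasDerivAt.clm_apply (F := E) (G := E →L[ℝ] ℝ) hT hl
    exact hT'.clm_apply_const e
  have h4 := (hasFDerivAt_norm_rpow (u + t • d) (by linarith : 1 < 1 + ν)).hasDerivAt_add_smul
  have h5 : HasDerivAt (fun s : ℝ => ⟪u + s • d, e⟫_ℝ) ⟪d, e⟫_ℝ t := by
    simpa using hl.inner ℝ (hasDerivAt_const t e)
  have := (((h2.const_add (ℓ e)).add (h3.const_mul (1 / 2)))).add ((h4.mul h5).const_mul b)
  have e1 : (1 : ℝ) + ν - 2 = ν - 1 := by ring
  have hfun : (fun s : ℝ => regModelDeriv ℓ A T b ν (u + s • d) e) = fun s : ℝ =>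
      ℓ e + A (u + s • d) e + 1 / 2 * T (u + s • d) (u + s • d) e
        + b * (‖u + s • d‖ ^ (1 + ν) * ⟪u + s • d, e⟫_ℝ) := by
    ext s
    simp only [regModelDeriv, add_apply, smul_apply,
      smul_eq_mul, innerSL_apply_apply]
    ring
  rw [hfun]
  refine HasDerivAt.congr_deriv this ?_
  simp only [smul_apply, smul_eq_mul, innerSL_apply_apply, e1, normPowHess]
  rw [hT₁ d]
  ring

theorem first_order_of_deriv_line_nonneg {φ : E → ℝ} {φ' : E → E →L[ℝ] ℝ} {Q : E → E → ℝ}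
    (hφ : ∀ z, HasFDerivAt φ (φ' z) z)
    (hQ : ∀ u d (t : ℝ), HasDerivAt (fun s : ℝ => φ' (u + s • d) d) (Q (u + t • d) d) t)
    (hnn : ∀ h d, 0 ≤ Q h d) (u v : E) : φ u + φ' u (v - u) ≤ φ v := by
  set d := v - u with hd
  have h1 : ∀ t : ℝ, HasDerivAt (fun s : ℝ => φ (u + s • d)) (φ' (u + t • d) d) t := fun t =>
    (hφ (u + t • d)).hasDerivAt_add_smul
  have hmono : Monotone fun s : ℝ => φ' (u + s • d) d :=
    monotone_of_deriv_nonneg (fun t => (hQ u d t).differentiableAt) fun t => by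
      rw [(hQ u d t).deriv]; exact hnn _ _
  obtain ⟨c, hc, hceq⟩ := exists_hasDerivAt_eq_slope (fun s : ℝ => φ (u + s • d)) _ zero_lt_one
    (fun t _ => (h1 t).continuousAt.continuousWithinAt) fun t _ => h1 t
  have := hmono hc.1.le
  have hv : u + d = v := by rw [hd]; abel
  simp only [zero_smul, one_smul, add_zero, hv, sub_zero, div_one] at this hceq
  linarith

theorem regModel_first_order (hν : 0 < ν) (hA : ∀ u v, A u v = A v u)
    (hT₁ : ∀ u v w, T u v w = T v u w) (hT₂ : ∀ u v w, T u v w = T u w v)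
    (hnn : ∀ h d, 0 ≤ A d d + T h d d + b * normPowHess ν h d d) (u v : E) :
    regModel a ℓ A T b ν u + regModelDeriv ℓ A T b ν u (v - u) ≤ regModel a ℓ A T b ν v :=
  first_order_of_deriv_line_nonneg (hasFDerivAt_regModel hν hA hT₁ hT₂)
    (Q := fun h d => A d d + T h d d + b * normPowHess ν h d d)
    (fun u d t => hasDerivAt_regModelDeriv_line hν hT₁ u d d t) hnn u v

/-- Strong monotonicity of the gradient of `‖h‖ ^ (3 + ν) / (3 + ν)`. -/
theorem normPow_grad_strongly_monotone (hν : 0 < ν) (u v : E) :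
    (2 : ℝ) ^ (-(2 + ν)) * ‖v - u‖ ^ (3 + ν) ≤
      ‖v‖ ^ (1 + ν) * ⟪v, v - u⟫_ℝ - ‖u‖ ^ (1 + ν) * ⟪u, v - u⟫_ℝ := by
  set a := ‖v‖ ^ (1 + ν)
  set b := ‖u‖ ^ (1 + ν)
  have hq : 0 ≤ 1 + ν := by linarith
  have hid : a * ⟪v, v - u⟫_ℝ - b * ⟪u, v - u⟫_ℝ =
      (a + b) / 2 * ‖v - u‖ ^ 2 + (a - b) * (‖v‖ ^ 2 - ‖u‖ ^ 2) / 2 := by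
    rw [norm_sub_sq_real, inner_sub_right, inner_sub_right, real_inner_self_eq_norm_sq,
      real_inner_self_eq_norm_sq, real_inner_comm]
    ring
  have hcross : 0 ≤ (a - b) * (‖v‖ ^ 2 - ‖u‖ ^ 2) := by
    rcases le_total ‖u‖ ‖v‖ with h | h
    · exact mul_nonneg (sub_nonneg.2 (Real.rpow_le_rpow (norm_nonneg _) h hq))
        (sub_nonneg.2 (by gcongr))
    · exact mul_nonneg_of_nonpos_of_nonpos
        (sub_nonpos.2 (Real.rpow_le_rpow (norm_nonneg _) h hq)) (sub_nonpos.2 (by gcongr))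
  have hab : (‖v - u‖ / 2) ^ (1 + ν) ≤ a + b := by
    have htri := norm_sub_le v u
    rcases le_total ‖u‖ ‖v‖ with h | h
    · have : (‖v - u‖ / 2) ^ (1 + ν) ≤ a :=
        Real.rpow_le_rpow (by positivity) (by linarith) hq
      have : 0 ≤ b := by positivity
      linarith
    · have : (‖v - u‖ / 2) ^ (1 + ν) ≤ b :=
        Real.rpow_le_rpow (by positivity) (by linarith) hq
      have : 0 ≤ a := by positivity
      linarith
  have hL : (2 : ℝ) ^ (-(2 + ν)) * ‖v - u‖ ^ (3 + ν) =
      (‖v - u‖ / 2) ^ (1 + ν) / 2 * ‖v - u‖ ^ 2 := by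
    have e1 : ‖v - u‖ ^ (3 + ν) = ‖v - u‖ ^ (1 + ν) * ‖v - u‖ ^ 2 := by
      rw [← Real.rpow_natCast ‖v - u‖ 2, ← Real.rpow_add_of_nonneg (norm_nonneg _) hq (by simp)]
      congr 1; push_cast; ring
    have e2 : (2 : ℝ) ^ (2 + ν) = 2 ^ (1 + ν) * 2 := by
      rw [← Real.rpow_add_one (by norm_num)]; congr 1; ring
    rw [e1, Real.div_rpow (norm_nonneg _) (by norm_num), Real.rpow_neg (by norm_num), e2]
    field_simp
  rw [hL, hid]
  have := mul_le_mul_of_nonneg_right hab (sq_nonneg ‖v - u‖)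
  linarith

end RegularizedModel

section ThirdOrder

theorem iteratedFDeriv_three_apply {E F : Type*} [NormedAddCommGroup E] [NormedSpace ℝ E]
    [NormedAddCommGroup F] [NormedSpace ℝ F] (f : E → F) (x u v w : E) :
    iteratedFDeriv ℝ 3 f x ![u, v, w] = fderiv ℝ (fderiv ℝ (fderiv ℝ f)) x u v w := by
  rw [iteratedFDeriv_succ_apply_right, iteratedFDeriv_two_apply]
  rfl

variable {E : Type*} [NormedAddCommGroup E] [NormedSpace ℝ E] {f : E → ℝ}

theorem ConvexOn.fderiv_fderiv_nonneg (hf : ContDiff ℝ 2 f) (hconv : ConvexOn ℝ Set.univ f)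
    (y d : E) : 0 ≤ fderiv ℝ (fderiv ℝ f) y d d := by
  have h1 : ∀ t : ℝ, HasDerivAt (fun s : ℝ => f (y + s • d)) (fderiv ℝ f (y + t • d) d) t :=
    fun t => ((hf.differentiable (by norm_num)) _).hasFDerivAt.hasDerivAt_add_smul
  have hf' : Differentiable ℝ (fderiv ℝ f) :=
    (hf.fderiv_right (m := 1) (by norm_num)).differentiable (by norm_num)
  have h2 : HasDerivAt (fun s : ℝ => fderiv ℝ f (y + s • d) d) (fderiv ℝ (fderiv ℝ f) y d d) 0 := by
    simpa using (hf' (y + (0 : ℝ) • d)).hasFDerivAt.hasDerivAt_add_smul.clm_apply_const d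
  have hc : ConvexOn ℝ Set.univ fun s : ℝ => f (y + s • d) := by
    have := hconv.comp_affineMap (AffineMap.lineMap y (y + d))
    rw [Set.preimage_univ] at this
    refine this.congr fun s _ => ?_
    simp [AffineMap.lineMap_apply, add_comm]
  have hmono : Monotone fun s : ℝ => fderiv ℝ f (y + s • d) d := by
    have := hc.monotoneOn_deriv fun t _ => (h1 t).differentiableAt
    rw [monotoneOn_univ] at this
    convert this using 2 with s
    exact (h1 s).deriv.symm
  rw [← h2.deriv]
  exact hmono.deriv_nonneg

theorem fderiv_fderiv_symm (hf : ContDiff ℝ 2 f) (x u v : E) :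
    fderiv ℝ (fderiv ℝ f) x u v = fderiv ℝ (fderiv ℝ f) x v u :=
  hf.contDiffAt.isSymmSndFDerivAt (by simp) u v

theorem fderiv_three_symm_left (hf : ContDiff ℝ 3 f) (x u v w : E) :
    fderiv ℝ (fderiv ℝ (fderiv ℝ f)) x u v w = fderiv ℝ (fderiv ℝ (fderiv ℝ f)) x v u w := by
  have hf' : ContDiff ℝ 2 (fderiv ℝ f) := hf.fderiv_right (by norm_num)
  rw [hf'.contDiffAt.isSymmSndFDerivAt (by simp) u v]

theorem hasDerivAt_fderiv_fderiv_line (hf : ContDiff ℝ 3 f) (x h u v : E) (t : ℝ) :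
    HasDerivAt (fun s : ℝ => fderiv ℝ (fderiv ℝ f) (x + s • h) u v)
      (fderiv ℝ (fderiv ℝ (fderiv ℝ f)) (x + t • h) h u v) t := by
  have hf' : ContDiff ℝ 2 (fderiv ℝ f) := hf.fderiv_right (by norm_num)
  have hf'' : Differentiable ℝ (fderiv ℝ (fderiv ℝ f)) :=
    (hf'.fderiv_right (m := 1) (by norm_num)).differentiable (by norm_num)
  exact ((HasFDerivAt.hasDerivAt_add_smul (F := E →L[ℝ] E →L[ℝ] ℝ)
    (hf'' (x + t • h)).hasFDerivAt).clm_apply_const u).clm_apply_const v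

theorem fderiv_three_symm_right (hf : ContDiff ℝ 3 f) (x u v w : E) :
    fderiv ℝ (fderiv ℝ (fderiv ℝ f)) x u v w = fderiv ℝ (fderiv ℝ (fderiv ℝ f)) x u w v := by
  have h1 := hasDerivAt_fderiv_fderiv_line hf x u v w 0
  have h2 := hasDerivAt_fderiv_fderiv_line hf x u w v 0
  simp_rw [fderiv_fderiv_symm (hf.of_le (by norm_num)) _ w v] at h2
  simpa using h1.unique h2

/-- A convex function with Hölder third derivative has a second-order Taylor expansion of its
Hessian that is nonnegative up to the Hölder remainder. -/
theorem ConvexOn.hessian_taylor_ge (hf : ContDiff ℝ 3 f) (hconv : ConvexOn ℝ Set.univ f)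
    {ν C : ℝ} (hν : 0 < ν) (hC : 0 ≤ C) {x : E}
    (hHolder : ∀ y, ‖iteratedFDeriv ℝ 3 f y - iteratedFDeriv ℝ 3 f x‖ ≤ C * ‖y - x‖ ^ ν)
    (h d : E) :
    -(C * ‖h‖ ^ (1 + ν) * ‖d‖ ^ 2) ≤
      fderiv ℝ (fderiv ℝ f) x d d + fderiv ℝ (fderiv ℝ (fderiv ℝ f)) x h d d := by
  set T := fun y => fderiv ℝ (fderiv ℝ (fderiv ℝ f)) y h d d with hT
  have hline : ∀ t : ℝ, HasDerivAt
      (fun s : ℝ => fderiv ℝ (fderiv ℝ f) (x + s • h) d d - s * T x) (T (x + t • h) - T x) t :=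
    fun t => by
      have := (hasDerivAt_fderiv_fderiv_line hf x h d d t).sub
        ((hasDerivAt_id t).mul_const (T x))
      rw [one_mul] at this
      exact this
  obtain ⟨c, hc, hceq⟩ := exists_hasDerivAt_eq_slope _ _ zero_lt_one
    (fun t _ => (hline t).continuousAt.continuousWithinAt) fun t _ => hline t
  have hbound : |T (x + c • h) - T x| ≤ C * ‖h‖ ^ (1 + ν) * ‖d‖ ^ 2 := by
    have h1 := (iteratedFDeriv ℝ 3 f (x + c • h) - iteratedFDeriv ℝ 3 f x).le_opNorm ![h, d, d]
    rw [sub_apply, iteratedFDeriv_three_apply,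
      iteratedFDeriv_three_apply, Fin.prod_univ_three, Real.norm_eq_abs] at h1
    refine h1.trans ?_
    have h2 : ‖iteratedFDeriv ℝ 3 f (x + c • h) - iteratedFDeriv ℝ 3 f x‖ ≤ C * ‖h‖ ^ ν := by
      refine (hHolder _).trans ?_
      gcongr
      rw [add_sub_cancel_left, norm_smul, Real.norm_eq_abs, abs_of_pos hc.1]
      exact mul_le_of_le_one_left (norm_nonneg _) hc.2.le
    calc _ ≤ C * ‖h‖ ^ ν * (‖h‖ * ‖d‖ * ‖d‖) :=
          mul_le_mul_of_nonneg_right h2 (by positivity)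
      _ = C * (‖h‖ * ‖h‖ ^ ν) * ‖d‖ ^ 2 := by ring
      _ = _ := by rw [Real.rpow_add_of_nonneg (norm_nonneg _) zero_le_one hν.le, Real.rpow_one]
  have hnn := hconv.fderiv_fderiv_nonneg (hf.of_le (by norm_num)) (x + h) d
  have := le_of_abs_le hbound
  simp only [one_smul, zero_smul, add_zero, one_mul, zero_mul, sub_zero, div_one] at hceq
  have hTx : T x = fderiv ℝ (fderiv ℝ (fderiv ℝ f)) x h d d := rfl
  linarith

end ThirdOrder

section BregmanProximalGradient

variable {E : Type*} [NormedAddCommGroup E] [InnerProductSpace ℝ E] [CompleteSpace E]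
  {g d : E → ℝ} {M : ℝ} {u w : E}

theorem hasFDerivAt_breg (hd : DifferentiableAt ℝ d w) :
    HasFDerivAt (breg d u) (fderiv ℝ d w - innerSL ℝ (gradient d u)) w := by
  have h1 := (innerSL ℝ (gradient d u)).hasFDerivAt.comp w ((hasFDerivAt_id w).sub_const u)
  exact (hd.hasFDerivAt.sub_const (d u)).sub h1

theorem stepOK.optimality (h : stepOK g d M u w) (hd : DifferentiableAt ℝ d w) (v : E) :
    ⟪gradient g u, v⟫_ℝ = M * (⟪gradient d u, v⟫_ℝ - ⟪gradient d w, v⟫_ℝ) := by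
  have h1 := (innerSL ℝ (gradient g u)).hasFDerivAt.comp w ((hasFDerivAt_id w).sub_const u)
  have h2 := h1.add ((hasFDerivAt_breg (u := u) hd).const_mul M)
  have hmin : IsLocalMin (fun z => ⟪gradient g u, z - u⟫_ℝ + M * breg d u z) w :=
    Filter.Eventually.of_forall h.1
  have h3 := congrArg (fun φ : E →L[ℝ] ℝ => φ v) (hmin.hasFDerivAt_eq_zero h2)
  simp only [add_apply, ContinuousLinearMap.comp_apply, ContinuousLinearMap.id_apply, smul_apply,
    sub_apply, innerSL_apply_apply, zero_apply, smul_eq_mul] at h3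
  rw [inner_gradient_left (x := w)]
  linarith

theorem stepOK.decrease (h : stepOK g d M u w) (hd : DifferentiableAt ℝ d w) :
    M * breg d w u ≤ g u - g w := by
  have h1 := h.optimality hd (w - u)
  have h2 := h.2
  have h3 : ⟪gradient d w, u - w⟫_ℝ = -⟪gradient d w, w - u⟫_ℝ := by
    rw [← inner_neg_right, neg_sub]
  simp only [breg, h3, h1] at h2 ⊢
  linarith

theorem stepOK.three_point (h : stepOK g d M u w) (hd : DifferentiableAt ℝ d w) {z : E}
    (hg : g u + ⟪gradient g u, z - u⟫_ℝ ≤ g z) :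
    g w - g z ≤ M * (breg d u z - breg d w z) := by
  have h1 := h.optimality hd (w - u)
  have h1' := h.optimality hd (z - u)
  have h2 := h.2
  have h3 : ⟪gradient d w, z - w⟫_ℝ = ⟪gradient d w, z - u⟫_ℝ - ⟪gradient d w, w - u⟫_ℝ := by
    rw [← inner_sub_right]; congr 1; abel
  simp only [breg, h3, h1] at h2 ⊢
  linarith

/-- Relative smoothness and growth of the Bregman distance make a large enough step exist. -/
theorem exists_stepOK [FiniteDimensional ℝ E] (hd : Differentiable ℝ d) {c p Λ : ℝ} (hc : 0 < c)
    (hp : 2 ≤ p) (hbreg : ∀ u v, c * ‖v - u‖ ^ p ≤ breg d u v) (hM : 0 < M) (hΛ : Λ ≤ M)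
    (hrel : ∀ v, g v ≤ g u + ⟪gradient g u, v - u⟫_ℝ + Λ * breg d u v) :
    ∃ w, stepOK g d M u w := by
  have hb0 : ∀ v, 0 ≤ breg d u v := fun v => le_trans (by positivity) (hbreg u v)
  have hcont : Continuous fun z => ⟪gradient g u, z - u⟫_ℝ + M * breg d u z := by
    have := hd.continuous
    unfold breg
    fun_prop
  have hbu : breg d u u = 0 := by simp [breg]
  obtain ⟨w, hw⟩ := hcont.exists_forall_le' u (by
    have htend := (tendsto_norm_cocompact_atTop (E := E)).eventually_ge_atTop
      (1 + ‖gradient g u‖ / (M * c) + ‖u‖)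
    filter_upwards [htend] with z hz
    set r := ‖z - u‖ with hr
    have hzr : ‖z‖ ≤ r + ‖u‖ := by simpa using norm_add_le (z - u) u
    have h0 : 0 ≤ ‖gradient g u‖ / (M * c) := by positivity
    have hr1 : 1 ≤ r := by linarith
    have hr2 : ‖gradient g u‖ ≤ r * (M * c) :=
      (div_le_iff₀ (by positivity)).1 (by linarith)
    have hpow : r ^ 2 ≤ r ^ p := by
      rw [← Real.rpow_natCast]
      exact Real.rpow_le_rpow_of_exponent_le hr1 (by exact_mod_cast hp)
    have h1 := neg_le_of_abs_le (abs_real_inner_le_norm (gradient g u) (z - u))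
    have h2 := mul_le_mul_of_nonneg_left (hbreg u z) hM.le
    have h3 := mul_le_mul_of_nonneg_left hpow (mul_pos hM hc).le
    have h4 := mul_le_mul_of_nonneg_right hr2 (zero_le_one.trans hr1)
    rw [hbu, sub_self, inner_zero_right]
    rw [← hr] at h1 h2
    linarith)
  refine ⟨w, hw, (hrel w).trans ?_⟩
  have := mul_le_mul_of_nonneg_right hΛ (hb0 w)
  linarith

variable {L0 Λ : ℝ} {y : ℕ → E} {L : ℕ → ℝ} {i : ℕ → ℕ}

theorem algA.coeff_pos (h : algA g d L0 y L i) (hL0 : 0 < L0) (k : ℕ) : 0 < L k := by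
  induction k with
  | zero => rw [h.1]; exact hL0
  | succ k ih => rw [(h.2 k).2.2]; positivity

theorem algA.coeff_le (h : algA g d L0 y L i) (hL0 : 0 < L0)
    (hex : ∀ k M, 0 < M → Λ ≤ M → ∃ w, stepOK g d M (y k) w) (k : ℕ) :
    (2 : ℝ) ^ i k * L k ≤ max L0 (2 * Λ) := by
  have hstep : ∀ k, L k ≤ max L0 (2 * Λ) → (2 : ℝ) ^ i k * L k ≤ max L0 (2 * Λ) := by
    intro k hk
    rcases Nat.eq_zero_or_pos (i k) with hi | hi
    · simpa [hi] using hk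
    · obtain ⟨j, hj⟩ := Nat.exists_eq_succ_of_ne_zero hi.ne'
      have hpos := h.coeff_pos hL0 k
      have hlt : (2 : ℝ) ^ j * L k < Λ := by
        by_contra! hge
        exact (h.2 k).2.1 j (by omega) (hex k _ (by positivity) hge)
      rw [hj, Nat.succ_eq_add_one, pow_succ]
      exact le_max_of_le_right (by linarith)
  refine hstep k ?_
  induction k with
  | zero => rw [h.1]; exact le_max_left _ _
  | succ k ih =>
    have hpos := h.coeff_pos hL0 (k + 1)
    have := (h.2 k).2.2
    have := hstep k ih
    linarith

theorem algA.antitone (h : algA g d L0 y L i) (hL0 : 0 < L0) (hd : Differentiable ℝ d)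
    (hbreg : ∀ u v, 0 ≤ breg d u v) : Antitone fun k => g (y k) := by
  refine antitone_nat_of_succ_le fun k => ?_
  have h1 := (h.2 k).1.decrease (hd _)
  have h2 := h.coeff_pos hL0 k
  have h3 : 0 ≤ (2 : ℝ) ^ i k * L k * breg d (y (k + 1)) (y k) :=
    mul_nonneg (by positivity) (hbreg _ _)
  linarith

/-- The sublinear rate of the adaptive Bregman proximal gradient method on a convex function. -/
theorem algA.sublinear_rate (h : algA g d L0 y L i) (hL0 : 0 < L0) (hd : Differentiable ℝ d)
    (hbreg : ∀ u v, 0 ≤ breg d u v) (hg : ∀ u v, g u + ⟪gradient g u, v - u⟫_ℝ ≤ g v)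
    (hM : ∀ k, (2 : ℝ) ^ i k * L k ≤ M) {S : E} (hS : ∀ z, g S ≤ g z) (n : ℕ) :
    n * (g (y n) - g S) ≤ M * breg d (y 0) S := by
  have hM0 : 0 < M := lt_of_lt_of_le (mul_pos (by positivity) (h.coeff_pos hL0 0)) (hM 0)
  have hanti := h.antitone hL0 hd hbreg
  have hstep : ∀ k, g (y (k + 1)) - g S ≤ M * (breg d (y k) S - breg d (y (k + 1)) S) := by
    intro k
    have h1 := (h.2 k).1.three_point (hd _) (hg (y k) S)
    have hpos : 0 < (2 : ℝ) ^ i k * L k := mul_pos (by positivity) (h.coeff_pos hL0 k)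
    have h2 : 0 ≤ breg d (y k) S - breg d (y (k + 1)) S :=
      nonneg_of_mul_nonneg_right ((sub_nonneg.2 (hS _)).trans h1) hpos
    exact h1.trans (mul_le_mul_of_nonneg_right (hM k) h2)
  have hind : n * (g (y n) - g S) ≤ M * (breg d (y 0) S - breg d (y n) S) := by
    induction n with
    | zero => simp
    | succ n ih =>
      have h1 := hstep n
      have h2 : (n : ℝ) * (g (y (n + 1)) - g (y n)) ≤ 0 :=
        mul_nonpos_of_nonneg_of_nonpos (by positivity) (sub_nonpos.2 (hanti n.le_succ))
      push_cast
      linarith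
  have := mul_nonneg hM0.le (hbreg (y n) S)
  linarith

theorem stepOK.grad_norm_le (h : stepOK g d M u w) (hd : DifferentiableAt ℝ d w) (hM : 0 < M)
    {N : ℝ} (hN : ∀ v, ⟪gradient d u, v⟫_ℝ - ⟪gradient d w, v⟫_ℝ ≤ N * ‖u - w‖ * ‖v‖) :
    ‖gradient g u‖ ≤ M * N * ‖u - w‖ := by
  rcases (norm_nonneg (gradient g u)).eq_or_lt' with h0 | h0
  · have h1 := h.optimality hd
    by_cases hv : ∃ v : E, v ≠ 0
    · obtain ⟨v, hv⟩ := hv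
      have h2 := hN v
      have h3 := h1 v
      rw [norm_eq_zero.1 h0, inner_zero_left] at h3
      rcases mul_eq_zero.1 h3.symm with h4 | h4
      · exact absurd h4 hM.ne'
      · rw [h4] at h2
        have := nonneg_of_mul_nonneg_left h2 (norm_pos_iff.2 hv)
        rw [h0, mul_assoc]
        exact mul_nonneg hM.le this
    · push Not at hv
      simp [h0, hv (u - w)]
  · have h1 := h.optimality hd (gradient g u)
    rw [real_inner_self_eq_norm_sq] at h1
    have h2 := mul_le_mul_of_nonneg_left (hN (gradient g u)) hM.le
    refine le_of_mul_le_mul_right ?_ h0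
    linarith

theorem algA.iteration_sq_le (h : algA g d L0 y L i) (hL0 : 0 < L0) (hd : Differentiable ℝ d)
    (hg : ∀ u v, g u + ⟪gradient g u, v - u⟫_ℝ ≤ g v)
    (hM : ∀ k, (2 : ℝ) ^ i k * L k ≤ M) {S : E} (hS : ∀ z, g S ≤ g z)
    {c p N ε : ℝ} (hc : 0 < c) (hp : 1 ≤ p) (hN0 : 0 ≤ N) (hε : 0 < ε)
    (hbreg : ∀ u v, c * ‖v - u‖ ^ p ≤ breg d u v)
    (hN : ∀ k v, ⟪gradient d (y k), v⟫_ℝ - ⟪gradient d (y (k + 1)), v⟫_ℝ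
      ≤ N * ‖y k - y (k + 1)‖ * ‖v‖)
    {n : ℕ} (hgrad : ∀ k ≤ 2 * n, ε < ‖gradient g (y k)‖) :
    (n : ℝ) ^ 2 * (c * ε ^ p) ≤ (M * N) ^ p * breg d (y 0) S := by
  have hM0 : 0 < M := lt_of_lt_of_le (mul_pos (by positivity) (h.coeff_pos hL0 0)) (hM 0)
  have hb0 : ∀ u v, 0 ≤ breg d u v := fun u v => le_trans (by positivity) (hbreg u v)
  have hdec : ∀ k ≤ 2 * n, c * ε ^ p * M ≤ (M * N) ^ p * (g (y k) - g (y (k + 1))) := by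
    intro k hk
    set m := (2 : ℝ) ^ i k * L k with hm
    have hm0 : 0 < m := mul_pos (by positivity) (h.coeff_pos hL0 k)
    set r := ‖y k - y (k + 1)‖ with hr
    have hr0 : 0 ≤ r := norm_nonneg _
    have h1 := (h.2 k).1.grad_norm_le (hd _) hm0 (hN k)
    have h2 : ε ^ p ≤ (m * N * r) ^ p :=
      Real.rpow_le_rpow hε.le ((hgrad k hk).le.trans h1) (by linarith)
    have h3 := (h.2 k).1.decrease (hd _)
    have h4 := mul_le_mul_of_nonneg_left (hbreg (y (k + 1)) (y k)) hm0.le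
    have h5 : m ^ (p - 1) ≤ M ^ (p - 1) := Real.rpow_le_rpow hm0.le (hM k) (by linarith)
    have e1 : m ^ p = m ^ (p - 1) * m := by
      rw [← Real.rpow_add_one hm0.ne']; congr 1; ring
    have e2 : M ^ p = M ^ (p - 1) * M := by
      rw [← Real.rpow_add_one hM0.ne']; congr 1; ring
    calc c * ε ^ p * M ≤ c * (m * N * r) ^ p * M := by gcongr
      _ = c * (m ^ (p - 1) * m * N ^ p * r ^ p) * M := by
          rw [Real.mul_rpow (by positivity) hr0, Real.mul_rpow hm0.le hN0, e1]
      _ ≤ c * (M ^ (p - 1) * m * N ^ p * r ^ p) * M := by gcongr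
      _ = (M * N) ^ p * (m * (c * r ^ p)) := by rw [Real.mul_rpow hM0.le hN0, e2]; ring
      _ ≤ _ := by
          gcongr
          exact h4.trans h3
  have hsum : ∀ j ≤ n, j * (c * ε ^ p * M) ≤ (M * N) ^ p * (g (y n) - g (y (n + j))) := by
    intro j
    induction j with
    | zero => simp
    | succ j ih =>
      intro hj
      have h1 := ih (by omega)
      have h2 := hdec (n + j) (by omega)
      rw [← add_assoc]
      push_cast
      linarith
  have h1 := hsum n le_rfl
  have h2 : (M * N) ^ p * (g (y n) - g (y (n + n))) ≤ (M * N) ^ p * (g (y n) - g S) := by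
    gcongr
    exact hS _
  have h3 := h.sublinear_rate hL0 hd hb0 hg hM hS n
  refine le_of_mul_le_mul_right ?_ hM0
  calc (n : ℝ) ^ 2 * (c * ε ^ p) * M = n * (n * (c * ε ^ p * M)) := by ring
    _ ≤ n * ((M * N) ^ p * (g (y n) - g S)) :=
        mul_le_mul_of_nonneg_left (h1.trans h2) (Nat.cast_nonneg n)
    _ = (M * N) ^ p * (n * (g (y n) - g S)) := by ring
    _ ≤ (M * N) ^ p * (M * breg d (y 0) S) := by gcongr
    _ = _ := by ring

end BregmanProximalGradient

section RegularizedModelBregman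

variable {E : Type*} [NormedAddCommGroup E] [InnerProductSpace ℝ E]
  {a b ν : ℝ} {ℓ : E →L[ℝ] ℝ} {A : E →L[ℝ] E →L[ℝ] ℝ} {T : E →L[ℝ] E →L[ℝ] E →L[ℝ] ℝ} {x : E}

theorem hasFDerivAt_regModel_sub (hν : 0 < ν) (hA : ∀ u v, A u v = A v u)
    (hT₁ : ∀ u v w, T u v w = T v u w) (hT₂ : ∀ u v w, T u v w = T u w v) (y : E) :
    HasFDerivAt (fun y => regModel a ℓ A T b ν (y - x)) (regModelDeriv ℓ A T b ν (y - x)) y :=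
  (hasFDerivAt_comp_sub x).2 (hasFDerivAt_regModel hν hA hT₁ hT₂ (y - x))

theorem norm_le_of_regModel_le (hν : 0 < ν) (hb : 0 < b) (hA0 : ∀ d, 0 ≤ A d d) {γ θ D : ℝ}
    (hγ : ∀ d, |ℓ d| ≤ γ * ‖d‖) (hθ : ∀ d, |T d d d| ≤ θ * ‖d‖ ^ 3)
    (hθ0 : 0 ≤ θ) (hD : 0 ≤ D)
    (hDγ : γ * (3 + ν) / b ≤ D ^ 2) (hDθ : 1 + θ * (3 + ν) / (6 * b) ≤ D ^ ν) {h : E}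
    (hle : regModel a ℓ A T b ν h ≤ a) : ‖h‖ ≤ D := by
  by_contra! hlt
  set r := ‖h‖ with hr
  have hr0 : 0 < r := hD.trans_lt hlt
  have hp : 0 < 3 + ν := by linarith
  have h1 := neg_le_of_abs_le (hγ h)
  have h2 := neg_le_of_abs_le (hθ h)
  have h3 := hA0 h
  have hpow : r ^ (3 + ν) = r ^ ν * r ^ 3 := by
    rw [add_comm, Real.rpow_add hr0]; norm_cast
  have hν' : D ^ ν < r ^ ν := Real.rpow_lt_rpow hD hlt hν
  have hsq : D ^ 2 < r ^ 2 := by gcongr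
  rw [regModel, ← hr, hpow] at hle
  rw [← hr] at h1 h2
  have hγ' : γ < r ^ 2 * (b / (3 + ν)) := by
    have := hDγ.trans_lt hsq
    rw [div_lt_iff₀ hb] at this
    rw [← mul_div_assoc, lt_div_iff₀ hp]
    exact this
  have hθ' : b / (3 + ν) + θ / 6 < r ^ ν * (b / (3 + ν)) := by
    have := mul_lt_mul_of_pos_right (hDθ.trans_lt hν') (div_pos hb hp)
    refine lt_of_eq_of_lt ?_ this
    field_simp
  have h4 := mul_lt_mul_of_pos_right hγ' hr0
  have h5 := mul_lt_mul_of_pos_right hθ' (pow_pos hr0 3)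
  nlinarith

theorem norm_add_smul_le_of_mem_Icc {F : Type*} [SeminormedAddCommGroup F] [NormedSpace ℝ F]
    {D t : ℝ} {h k : F} (hh : ‖h‖ ≤ D) (hk : ‖k‖ ≤ D) (ht : t ∈ Set.Icc (0 : ℝ) 1) :
    ‖h + t • (k - h)‖ ≤ D := by
  have := (convex_closedBall (0 : F) D).add_smul_sub_mem (mem_closedBall_zero_iff.2 hh)
    (mem_closedBall_zero_iff.2 hk) ht
  exact mem_closedBall_zero_iff.1 this

variable [CompleteSpace E]

theorem inner_gradient_regModel (hν : 0 < ν) (hA : ∀ u v, A u v = A v u)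
    (hT₁ : ∀ u v w, T u v w = T v u w) (hT₂ : ∀ u v w, T u v w = T u w v) (y v : E) :
    ⟪gradient (fun y => regModel a ℓ A T b ν (y - x)) y, v⟫_ℝ =
      regModelDeriv ℓ A T b ν (y - x) v := by
  rw [inner_gradient_left, (hasFDerivAt_regModel_sub hν hA hT₁ hT₂ y).fderiv]

theorem regModel_gradient_inequality (hν : 0 < ν) (hb : 0 ≤ b) (hA : ∀ u v, A u v = A v u)
    (hT₁ : ∀ u v w, T u v w = T v u w) (hT₂ : ∀ u v w, T u v w = T u w v)
    (hAT : ∀ h d, -(b * ‖h‖ ^ (1 + ν) * ‖d‖ ^ 2) ≤ A d d + T h d d) (u v : E) :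
    regModel a ℓ A T b ν (u - x)
      + ⟪gradient (fun y => regModel a ℓ A T b ν (y - x)) u, v - u⟫_ℝ
      ≤ regModel a ℓ A T b ν (v - x) := by
  rw [inner_gradient_regModel hν hA hT₁ hT₂]
  have := regModel_first_order (a := a) (ℓ := ℓ) (b := b) hν hA hT₁ hT₂ (fun h d => by
    have h1 := mul_le_mul_of_nonneg_left (normPowHess_self_ge hν h d) hb
    have h2 := hAT h d
    linarith) (u - x) (v - x)
  rwa [sub_sub_sub_cancel_right] at this

theorem breg_regModel_eq (hν : 0 < ν) (hA : ∀ u v, A u v = A v u) (u v : E) :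
    breg (fun y => regModel 0 0 A 0 1 ν (y - x)) u v =
      regModel 0 0 A 0 1 ν (v - x) - regModel 0 0 A 0 1 ν (u - x)
        - regModelDeriv 0 A 0 1 ν (u - x) (v - u) := by
  rw [breg, inner_gradient_regModel hν hA (by simp) (by simp)]

/-- Relative smoothness of the regularized cubic model with respect to its regularized quadratic
part. -/
theorem regModel_relative_smooth (hν : 0 < ν) (hA : ∀ u v, A u v = A v u)
    (hA0 : ∀ d, 0 ≤ A d d)
    (hT₁ : ∀ u v w, T u v w = T v u w) (hT₂ : ∀ u v w, T u v w = T u w v)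
    (hAT : ∀ h d, -(b * ‖h‖ ^ (1 + ν) * ‖d‖ ^ 2) ≤ A d d + T h d d)
    {Λ : ℝ} (hΛ : 2 ≤ Λ) (hb : 0 ≤ b) (hΛb : 2 * b ≤ Λ) (u v : E) :
    regModel a ℓ A T b ν (v - x) ≤ regModel a ℓ A T b ν (u - x)
      + ⟪gradient (fun y => regModel a ℓ A T b ν (y - x)) u, v - u⟫_ℝ
      + Λ * breg (fun y => regModel 0 0 A 0 1 ν (y - x)) u v := by
  rw [inner_gradient_regModel hν hA hT₁ hT₂, breg_regModel_eq hν hA]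
  have key := regModel_first_order (a := -a) (ℓ := -ℓ) (A := Λ • A - A) (T := (-1 : ℝ) • T)
    (b := Λ - b)
    (ν := ν) hν (fun u v => by simp [hA u v]) (fun u v w => by simp [hT₁ u v w])
    (fun u v w => by simp [hT₂ u v w]) (fun h d => by
      have h1 := normPowHess_self_ge hν h d
      have h2 := hAT (-h) d
      have h3 : 0 ≤ normPowHess ν h d d := le_trans (by positivity) h1
      have h4 := mul_le_mul_of_nonneg_left h1 hb
      have h5 := mul_nonneg (sub_nonneg.2 hΛ) (hA0 d)
      have h6 := mul_nonneg (sub_nonneg.2 hΛb) h3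
      simp only [map_neg, neg_apply, norm_neg, sub_apply, smul_apply, smul_eq_mul] at h2 ⊢
      linarith) (u - x) (v - x)
  rw [sub_sub_sub_cancel_right] at key
  simp only [regModel, regModelDeriv, neg_apply, sub_apply, add_apply, smul_apply, zero_apply,
    smul_eq_mul, innerSL_apply_apply] at key ⊢
  have e : ∀ r : ℝ, (Λ - b) / (3 + ν) * r = Λ * (1 / (3 + ν) * r) - b / (3 + ν) * r :=
    fun r => by ring
  rw [e, e] at key
  linarith

theorem breg_regModel_ge (hν : 0 < ν) (hA : ∀ u v, A u v = A v u) (hA0 : ∀ d, 0 ≤ A d d)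
    (u v : E) :
    (2 : ℝ) ^ (-(5 + 2 * ν)) * ‖v - u‖ ^ (3 + ν) ≤
      breg (fun y => regModel 0 0 A 0 1 ν (y - x)) u v := by
  rw [breg_regModel_eq hν hA]
  have hfo := regModel_first_order (a := 0) (ℓ := 0) (A := A) (T := 0) (b := 1) hν hA (by simp)
    (by simp) (fun h d => by
      have h1 : 0 ≤ normPowHess ν h d d := le_trans (by positivity) (normPowHess_self_ge hν h d)
      have h2 := hA0 d
      simp only [zero_apply]
      linarith)
  set p := u - x
  set q := v - x
  set e := (1 / 2 : ℝ) • (v - u) with he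
  have h2e : v - u = (2 : ℝ) • e := by rw [he, smul_smul]; norm_num
  have hq : q - (p + e) = e := by
    have : q - p = (2 : ℝ) • e := by rw [← h2e]; simp [p, q]
    rw [← sub_sub, this, two_smul]; abel
  have h1 := hfo (p + e) q
  have h2 := hfo p (p + e)
  rw [hq] at h1
  rw [add_sub_cancel_left] at h2
  have h3 := normPow_grad_strongly_monotone hν p (p + e)
  rw [add_sub_cancel_left] at h3
  have hnorm : ‖v - u‖ = 2 * ‖e‖ := by rw [h2e, norm_smul]; norm_num
  have hpow : (2 : ℝ) ^ (-(5 + 2 * ν)) * ‖v - u‖ ^ (3 + ν) =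
      (2 : ℝ) ^ (-(2 + ν)) * ‖e‖ ^ (3 + ν) := by
    rw [hnorm, Real.mul_rpow (by norm_num) (norm_nonneg _), ← mul_assoc,
      ← Real.rpow_add (by norm_num)]
    congr 2; ring
  rw [hpow, h2e, map_smul, smul_eq_mul]
  have h4 := hA0 e
  simp only [regModelDeriv, add_apply, smul_apply, zero_apply, map_add, inner_add_left,
    smul_eq_mul, innerSL_apply_apply] at h1 h2 h3 ⊢
  linarith

theorem gradient_regModel_lipschitz (hν : 0 < ν) (hA : ∀ u v, A u v = A v u) {α D : ℝ}
    (hα : ∀ d e, |A d e| ≤ α * (‖d‖ * ‖e‖)) {u w : E} (hu : ‖u - x‖ ≤ D) (hw : ‖w - x‖ ≤ D)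
    (v : E) :
    ⟪gradient (fun y => regModel 0 0 A 0 1 ν (y - x)) u, v⟫_ℝ
      - ⟪gradient (fun y => regModel 0 0 A 0 1 ν (y - x)) w, v⟫_ℝ
      ≤ (α + (2 + ν) * D ^ (1 + ν)) * ‖u - w‖ * ‖v‖ := by
  rw [inner_gradient_regModel hν hA (by simp) (by simp),
    inner_gradient_regModel hν hA (by simp) (by simp)]
  have hline := fun t => hasDerivAt_regModelDeriv_line (ℓ := 0) (A := A) (T := 0) (b := 1) hν
    (by simp) (w - x) (u - w) v t
  obtain ⟨c, hc, hceq⟩ := exists_hasDerivAt_eq_slope _ _ zero_lt_one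
    (fun t _ => (hline t).continuousAt.continuousWithinAt) fun t _ => hline t
  have hcn : ‖w - x + c • (u - w)‖ ≤ D := by
    have := norm_add_smul_le_of_mem_Icc hw hu ⟨hc.1.le, hc.2.le⟩
    rwa [sub_sub_sub_cancel_right] at this
  have h1 := le_of_abs_le (normPowHess_abs_le hν (w - x + c • (u - w)) (u - w) v)
  have h2 : (2 + ν) * ‖w - x + c • (u - w)‖ ^ (1 + ν) * (‖u - w‖ * ‖v‖) ≤
      (2 + ν) * D ^ (1 + ν) * (‖u - w‖ * ‖v‖) := by gcongr
  have h3 := le_of_abs_le (hα (u - w) v)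
  have e : w - x + (u - w) = u - x := by abel
  simp only [zero_apply, one_smul, zero_smul, add_zero, one_mul, sub_zero, div_one, e] at hceq
  rw [← hceq]
  linarith

end RegularizedModelBregman

section IterationBound

theorem breg_regModel_self_le {E : Type*} [NormedAddCommGroup E] [InnerProductSpace ℝ E]
    [CompleteSpace E] {ν α D N : ℝ} {A : E →L[ℝ] E →L[ℝ] ℝ} {x S : E}
    (hν : ν ∈ Set.Ioc (0 : ℝ) 1) (hA : ∀ u v, A u v = A v u)
    (hα : ∀ d e, |A d e| ≤ α * (‖d‖ * ‖e‖)) (hα0 : 0 ≤ α) (hD : 1 ≤ D)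
    (hN : N = α + (2 + ν) * D ^ 2) (hS : ‖S - x‖ ≤ D) :
    breg (fun y => regModel 0 0 A 0 1 ν (y - x)) x S ≤ (3 + ν) * N ^ 2 := by
  have hν0 := hν.1
  have hp : 3 ≤ 3 + ν := by linarith
  have h1 : A (S - x) (S - x) ≤ α * D ^ 2 := by
    refine (le_of_abs_le (hα _ _)).trans ?_
    rw [← sq]
    gcongr
  have h2 : ‖S - x‖ ^ (3 + ν) ≤ D ^ 4 := by
    refine (Real.rpow_le_rpow (norm_nonneg _) hS (by linarith)).trans ?_
    rw [← Real.rpow_natCast]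
    exact Real.rpow_le_rpow_of_exponent_le hD (by push_cast; linarith [hν.2])
  have h3 : 1 / (3 + ν) * ‖S - x‖ ^ (3 + ν) ≤ 1 * D ^ 4 := by
    gcongr
    rw [div_le_one (by linarith)]
    linarith
  have h4 : α * D ^ 2 + 2 * D ^ 4 ≤ N * D ^ 2 := by
    have : 0 ≤ ν * D ^ 4 := by positivity
    rw [hN]
    linarith
  have h5 : D ^ 2 ≤ N := by
    have : 0 ≤ (1 + ν) * D ^ 2 := by positivity
    linarith
  have hN0 : 0 ≤ N := (sq_nonneg D).trans h5
  have h6 : N * D ^ 2 ≤ N ^ 2 := by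
    rw [sq N]
    gcongr
  have h7 : 0 ≤ (2 + ν) * N ^ 2 := by positivity
  have h8 : 0 ≤ α * D ^ 2 := by positivity
  have h9 : (0 : ℝ) ^ (3 + ν) = 0 := Real.zero_rpow (by linarith)
  have h10 : 0 ≤ D ^ 4 := by positivity
  rw [breg_regModel_eq hν0 hA]
  simp only [regModel, regModelDeriv, sub_self, norm_zero, h9, zero_apply, map_zero,
    mul_zero, add_zero, zero_add, sub_zero, smul_zero]
  linarith

/-- The iteration count of the adaptive Bregman proximal gradient method on a regularized cubic
model, in terms of the magnitude of its coefficients. -/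
theorem algA.regModel_iteration_sq_le {E : Type*} [NormedAddCommGroup E] [InnerProductSpace ℝ E]
    [FiniteDimensional ℝ E] {a b ν α γ θ D N Λ L0 ε : ℝ} {ℓ : E →L[ℝ] ℝ}
    {A : E →L[ℝ] E →L[ℝ] ℝ} {T : E →L[ℝ] E →L[ℝ] E →L[ℝ] ℝ} {x : E}
    {y : ℕ → E} {L : ℕ → ℝ} {i : ℕ → ℕ}
    (h : algA (fun y => regModel a ℓ A T b ν (y - x)) (fun y => regModel 0 0 A 0 1 ν (y - x))
      L0 y L i) (hL0 : 0 < L0) (hy0 : y 0 = x)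
    (hν : ν ∈ Set.Ioc (0 : ℝ) 1) (hb : 0 < b) (hA : ∀ u v, A u v = A v u) (hA0 : ∀ d, 0 ≤ A d d)
    (hT₁ : ∀ u v w, T u v w = T v u w) (hT₂ : ∀ u v w, T u v w = T u w v)
    (hAT : ∀ h d, -(b * ‖h‖ ^ (1 + ν) * ‖d‖ ^ 2) ≤ A d d + T h d d)
    (hγ : ∀ d, |ℓ d| ≤ γ * ‖d‖) (hα : ∀ d e, |A d e| ≤ α * (‖d‖ * ‖e‖)) (hα0 : 0 ≤ α)
    (hθ : ∀ d, |T d d d| ≤ θ * ‖d‖ ^ 3) (hθ0 : 0 ≤ θ) (hD : 1 ≤ D)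
    (hDγ : γ * (3 + ν) / b ≤ D ^ 2) (hDθ : 1 + θ * (3 + ν) / (6 * b) ≤ D ^ ν)
    (hN : N = α + (2 + ν) * D ^ 2) (hΛ : 2 ≤ Λ) (hΛb : 2 * b ≤ Λ)
    (hattain : ∃ S : E, ∀ z : E, regModel a ℓ A T b ν (S - x) ≤ regModel a ℓ A T b ν (z - x))
    (hε : 0 < ε) {n : ℕ}
    (hgrad : ∀ k ≤ 2 * n, ε < ‖gradient (fun y => regModel a ℓ A T b ν (y - x)) (y k)‖) :
    (n : ℝ) ^ 2 * ((2 : ℝ) ^ (-(5 + 2 * ν)) * ε ^ (3 + ν)) ≤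
      (max L0 (2 * Λ) * N) ^ (3 + ν) * ((3 + ν) * N ^ 2) := by
  obtain ⟨S, hS⟩ := hattain
  have hν0 := hν.1
  have hD0 : 0 ≤ D := zero_le_one.trans hD
  have hd : Differentiable ℝ fun y => regModel 0 0 A 0 1 ν (y - x) := fun y =>
    (hasFDerivAt_regModel_sub hν0 hA (by simp) (by simp) y).differentiableAt
  have hbreg := breg_regModel_ge (x := x) hν0 hA hA0
  have hb0 : ∀ u v, 0 ≤ breg (fun y => regModel 0 0 A 0 1 ν (y - x)) u v := fun u v =>
    le_trans (by positivity) (hbreg u v)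
  have hx : regModel a ℓ A T b ν (x - x) = a := by
    simp [regModel, Real.zero_rpow (by linarith : 3 + ν ≠ 0)]
  have hball : ∀ {z}, regModel a ℓ A T b ν (z - x) ≤ a → ‖z - x‖ ≤ D :=
    norm_le_of_regModel_le hν0 hb hA0 hγ hθ hθ0 hD0 hDγ hDθ
  have hyD : ∀ k, ‖y k - x‖ ≤ D := fun k => hball <| by
    have := h.antitone hL0 hd hb0 k.zero_le
    simpa only [hy0, hx] using this
  have hSD : ‖S - x‖ ≤ D := hball ((hS x).trans_eq hx)
  have hN0 : 0 ≤ N := by rw [hN]; positivity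
  have hM := h.coeff_le hL0 fun k M hM hΛM =>
    exists_stepOK hd (by positivity) (by linarith) hbreg hM hΛM
      fun v => regModel_relative_smooth hν0 hA hA0 hT₁ hT₂ hAT hΛ hb.le hΛb (y k) v
  have hpow : D ^ (1 + ν) ≤ D ^ 2 := by
    rw [← Real.rpow_natCast]
    exact Real.rpow_le_rpow_of_exponent_le hD (by push_cast; linarith [hν.2])
  have hlip : ∀ k v, ⟪gradient (fun y => regModel 0 0 A 0 1 ν (y - x)) (y k), v⟫_ℝ
      - ⟪gradient (fun y => regModel 0 0 A 0 1 ν (y - x)) (y (k + 1)), v⟫_ℝ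
      ≤ N * ‖y k - y (k + 1)‖ * ‖v‖ := fun k v => by
    refine (gradient_regModel_lipschitz hν0 hA hα (hyD k) (hyD (k + 1)) v).trans ?_
    rw [hN]
    gcongr
  have key := h.iteration_sq_le hL0 hd
    (regModel_gradient_inequality hν0 hb.le hA hT₁ hT₂ hAT) hM hS (by positivity)
    (by linarith : 1 ≤ 3 + ν) hN0 hε hbreg hlip hgrad
  rw [hy0] at key
  refine key.trans ?_
  gcongr
  exact breg_regModel_self_le hν hA hα hα0 hD hN hSD

theorem le_of_sq_mul_rpow_le {ν ε M N t : ℝ} (hν : 0 < ν) (hε : 0 < ε) (hM : 0 ≤ M) (hN : 0 ≤ N)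
    (h : t ^ 2 * ((2 : ℝ) ^ (-(5 + 2 * ν)) * ε ^ (3 + ν)) ≤
      (M / 2 * N) ^ (3 + ν) * ((3 + ν) * N ^ 2)) :
    t ≤ (M * N) ^ ((3 + ν) / 2) * ((3 + ν) * (2 : ℝ) ^ (2 + ν) * N ^ 2) ^ ((1 : ℝ) / 2)
      * ε ^ (-(3 + ν) / 2) := by
  refine le_of_sq_le_sq ?_ (by positivity)
  have hsq : ∀ {z : ℝ}, 0 ≤ z → ∀ r : ℝ, (z ^ (r / 2)) ^ 2 = z ^ r := fun hz r => by
    rw [← Real.rpow_mul_natCast hz]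
    congr 1; push_cast; ring
  rw [mul_pow, mul_pow, hsq (by positivity), hsq (by positivity), hsq hε.le, Real.rpow_one,
    Real.rpow_neg hε.le, ← div_eq_mul_inv, le_div_iff₀ (by positivity)]
  have e1 : (M / 2 * N) ^ (3 + ν) = (M * N) ^ (3 + ν) * (2 : ℝ) ^ (-(3 + ν)) := by
    rw [Real.rpow_neg zero_le_two, ← div_eq_mul_inv, ← Real.div_rpow (by positivity) zero_le_two]
    congr 1; ring
  have e2 : (2 : ℝ) ^ (-(3 + ν)) = (2 : ℝ) ^ (-(5 + 2 * ν)) * (2 : ℝ) ^ (2 + ν) := by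
    rw [← Real.rpow_add zero_lt_two]
    congr 1; ring
  have hc : (0 : ℝ) < 2 ^ (-(5 + 2 * ν)) := by positivity
  rw [e1, e2] at h
  refine le_of_mul_le_mul_left ?_ hc
  linarith

end IterationBound

/-- Theorem 3.10(b). If `ν ∈ (0,1]`, `H = (6/(3+ν))·H_{f,3}(ν)`, `T = 3s`
with `s ≥ 1` and Algorithm 1 (Algorithm A applied to `Ω := Ω_{x,3,H}^{(ν)}` with reference
`ρ_x`, `y₀ = x`) satisfies `‖∇Ω(y_k)‖ > ε` for `k = 0, …, T`, then
`T ≤ 3[M_H·N̂_{x,H}]^{(3+ν)/2}·[(3+ν)·2^{2+ν}·N̂_{x,H}²]^{1/2}·ε^{−(3+ν)/2}`. -/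
theorem statement_9
    {E : Type*} [NormedAddCommGroup E] [InnerProductSpace ℝ E] [FiniteDimensional ℝ E]
    (ν Hf : ℝ) (hν : ν ∈ Set.Ioc (0 : ℝ) 1) (hHf : 0 < Hf)
    (f : E → ℝ) (hf : ContDiff ℝ 3 f) (hconv : ConvexOn ℝ Set.univ f)
    (hHolder : ∀ x y : E,
      ‖iteratedFDeriv ℝ 3 f x - iteratedFDeriv ℝ 3 f y‖ ≤ Hf * ‖x - y‖ ^ ν)
    (H : ℝ) (hH : H = 6 / (3 + ν) * Hf)
    (τH LH : ℝ)
    (hτH : τH = ((3 + ν) * H / (6 * Hf)) ^ (1 / (1 + ν)))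
    (hLH : LH = max ((τH + 1) / τH) (τH ^ ν * (τH + 1) * Hf))
    (x : E)
    (Ω ρ : E → ℝ)
    (hΩ : Ω = fun y => f x + ⟪gradient f x, y - x⟫_ℝ
        + (1 / 2) * iteratedFDeriv ℝ 2 f x ![y - x, y - x]
        + (1 / 6) * iteratedFDeriv ℝ 3 f x ![y - x, y - x, y - x]
        + (H / 6) * ‖y - x‖ ^ ((3 : ℝ) + ν))
    (hρ : ρ = fun y => (1 / 2) * iteratedFDeriv ℝ 2 f x ![y - x, y - x]
        + (1 / (3 + ν)) * ‖y - x‖ ^ ((3 : ℝ) + ν))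
    (hattain : ∃ S : E, ∀ z : E, Ω S ≤ Ω z)
    (L0 : ℝ) (hL0 : 0 < L0)
    (y : ℕ → E) (Lk : ℕ → ℝ) (ik : ℕ → ℕ)
    (hy0 : y 0 = x)
    (halg : algA Ω ρ L0 y Lk ik)
    (MH DxH Nhat : ℝ)
    (hMH : MH = max (2 * L0) (4 * LH))
    (hD : DxH = max (max 1 ((6 * ‖gradient f x‖ / H) ^ ((1 : ℝ) / 2)))
        (max (3 * ‖iteratedFDeriv ℝ 2 f x‖ / H)
          ((3 + ‖iteratedFDeriv ℝ 3 f x‖ / H) ^ (1 / ν))))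
    (hNhat : Nhat = ‖iteratedFDeriv ℝ 2 f x‖ + (2 + ν) * DxH ^ 2)
    (ε : ℝ) (hε : ε ∈ Set.Ioo (0 : ℝ) 1)
    (T s : ℕ) (hs : 1 ≤ s) (hTs : T = 3 * s)
    (hgrad : ∀ k ≤ T, ε < ‖gradient Ω (y k)‖) :
    (T : ℝ) ≤ 3 * (MH * Nhat) ^ (((3 : ℝ) + ν) / 2)
      * ((3 + ν) * (2 : ℝ) ^ ((2 : ℝ) + ν) * Nhat ^ 2) ^ ((1 : ℝ) / 2)
      * ε ^ (-((3 : ℝ) + ν) / 2) := by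
  have hν0 := hν.1
  have hp : 0 < 3 + ν := by linarith
  have hH0 : 0 < H := by rw [hH]; positivity
  have hHb : H / 6 = Hf / (3 + ν) := by rw [hH]; field_simp
  have hτ : τH = 1 := by
    rw [hτH, hH, show (3 + ν) * (6 / (3 + ν) * Hf) / (6 * Hf) = 1 by field_simp, Real.one_rpow]
  rw [hτ, Real.one_rpow] at hLH
  have hΛ : 2 ≤ LH := by rw [hLH]; exact le_max_of_le_left (by norm_num)
  have hΛb : 2 * Hf ≤ LH := by rw [hLH]; exact le_max_of_le_right (by linarith)
  have hΩ' : Ω = fun y => regModel (f x) (fderiv ℝ f x) (fderiv ℝ (fderiv ℝ f) x)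
      (fderiv ℝ (fderiv ℝ (fderiv ℝ f)) x) Hf ν (y - x) := by
    rw [hΩ]
    funext z
    rw [regModel, inner_gradient_left, iteratedFDeriv_two_apply, iteratedFDeriv_three_apply, hHb]
    rfl
  have hρ' : ρ = fun y => regModel 0 0 (fderiv ℝ (fderiv ℝ f) x) 0 1 ν (y - x) := by
    rw [hρ]
    funext z
    rw [regModel, iteratedFDeriv_two_apply]
    simp
  subst hΩ' hρ'
  have hD1 : 1 ≤ DxH := by rw [hD]; exact le_max_of_le_left (le_max_left _ _)
  have hDγ : ‖gradient f x‖ * (3 + ν) / Hf ≤ DxH ^ 2 := by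
    have h1 : (6 * ‖gradient f x‖ / H) ^ ((1 : ℝ) / 2) ≤ DxH := by
      rw [hD]; exact le_max_of_le_left (le_max_right _ _)
    rw [← Real.sqrt_eq_rpow, Real.sqrt_le_left (by linarith)] at h1
    refine le_of_eq_of_le ?_ h1
    rw [hH]
    field_simp
  have hDθ : 1 + ‖iteratedFDeriv ℝ 3 f x‖ * (3 + ν) / (6 * Hf) ≤ DxH ^ ν := by
    have h1 : (3 + ‖iteratedFDeriv ℝ 3 f x‖ / H) ^ (1 / ν) ≤ DxH := by
      rw [hD]; exact le_max_of_le_right (le_max_right _ _)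
    have h2 := Real.rpow_le_rpow (by positivity) h1 hν0.le
    rw [← Real.rpow_mul (by positivity), one_div_mul_cancel hν0.ne', Real.rpow_one] at h2
    have h3 : ‖iteratedFDeriv ℝ 3 f x‖ * (3 + ν) / (6 * Hf) = ‖iteratedFDeriv ℝ 3 f x‖ / H := by
      rw [hH]
      field_simp
    linarith
  have hM : max L0 (2 * LH) = MH / 2 := by
    rw [hMH, ← max_div_div_right zero_le_two]
    congr 1 <;> ring
  have hM0 : 0 ≤ MH := by rw [hMH]; exact le_max_of_le_left (by linarith)
  have hN0 : 0 ≤ Nhat := by rw [hNhat]; positivity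
  have key := halg.regModel_iteration_sq_le hL0 hy0 hν hHf
    (fderiv_fderiv_symm (hf.of_le (by norm_num)) x)
    (hconv.fderiv_fderiv_nonneg (hf.of_le (by norm_num)) x)
    (fderiv_three_symm_left hf x) (fderiv_three_symm_right hf x)
    (hconv.hessian_taylor_ge hf hν0 hHf.le fun z => hHolder z x)
    (fun d => by
      rw [← inner_gradient_left]
      exact abs_real_inner_le_norm _ _)
    (fun d e => by
      have := (iteratedFDeriv ℝ 2 f x).le_opNorm ![d, e]
      simpa [iteratedFDeriv_two_apply, Fin.prod_univ_two] using this)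
    (norm_nonneg _)
    (fun d => by
      have := (iteratedFDeriv ℝ 3 f x).le_opNorm ![d, d, d]
      rw [iteratedFDeriv_three_apply] at this
      simpa [Fin.prod_univ_three, pow_succ] using this)
    (norm_nonneg _) hD1 hDγ hDθ hNhat hΛ hΛb hattain hε.1
    (n := s) fun k hk => hgrad k (by omega)
  rw [hM] at key
  have := le_of_sq_mul_rpow_le hν0 hε.1 hM0 hN0 key
  rw [hTs]
  push_cast
  linarith
end

section
/- Let x, x⁺ ∈ E, H > 0, θ > 0, δ ∈ (0,1), and let g_φ(x⁺) be a subgradient of φ at x⁺. If ‖∇f(x⁺) + g_φ(x⁺)‖ ≥ δ and ‖∇Ω_{x,p,H}^{(ν)}(x⁺) + g_φ(x⁺)‖ ≤ min{1/2, θ·(p−1)!/(2[H_{f,p}(ν) + H(p+ν)])}·δ, then ‖∇Ω_{x,p,H}^{(ν)}(x⁺) + g_φ(x⁺)‖ ≤ θ·‖x⁺ − x‖^{p+ν−1}. -/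
open scoped InnerProductSpace

section Helpers

variable {E : Type*} [NormedAddCommGroup E] [NormedSpace ℝ E]

/-- The real-variable Taylor estimate for a chain of successive derivatives whose last member
varies by at most `C`. -/
lemma abs_sub_taylor_sum_le {C : ℝ} (n : ℕ) (a : ℕ → ℝ → ℝ)
    (ha : ∀ k < n, ∀ t, HasDerivAt (a k) (a (k + 1) t) t)
    (hC : ∀ t ∈ Set.Icc (0 : ℝ) 1, |a n t - a n 0| ≤ C) {t : ℝ} (ht : t ∈ Set.Icc (0 : ℝ) 1) :
    |a 0 t - ∑ k ∈ Finset.range (n + 1), a k 0 * (t ^ k / (k.factorial : ℝ))| ≤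
      C * (t ^ n / (n.factorial : ℝ)) := by
  induction n generalizing a t with
  | zero => simpa using hC t ht
  | succ n ih =>
    have hpow : ∀ (k : ℕ) (s : ℝ), HasDerivAt
        (fun s : ℝ => s ^ (k + 1) / ((k + 1).factorial : ℝ)) (s ^ k / (k.factorial : ℝ)) s := by
      intro k s
      refine ((hasDerivAt_pow (k + 1) s).div_const ((k + 1).factorial : ℝ)).congr_deriv ?_
      have := Nat.factorial_ne_zero k
      rw [Nat.factorial_succ]
      push_cast
      field_simp
    have hder : ∀ s, HasDerivAt
        (fun s => a 0 s - ∑ k ∈ Finset.range (n + 1 + 1), a k 0 * (s ^ k / (k.factorial : ℝ)))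
        (a 1 s - ∑ k ∈ Finset.range (n + 1), a (k + 1) 0 * (s ^ k / (k.factorial : ℝ))) s := by
      intro s
      simp only [Finset.sum_range_succ' _ (n + 1)]
      refine (ha 0 (by omega) s).sub ?_
      simp only [pow_zero]
      exact (HasDerivAt.fun_sum fun k _ => (hpow k s).const_mul (a (k + 1) 0)).add_const _
    refine image_norm_le_of_norm_deriv_right_le_deriv_boundary
      (f := fun s => a 0 s - ∑ k ∈ Finset.range (n + 1 + 1), a k 0 * (s ^ k / (k.factorial : ℝ)))
      (B := fun s => C * (s ^ (n + 1) / ((n + 1).factorial : ℝ)))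
      (fun s _ => (hder s).continuousAt.continuousWithinAt)
      (fun s _ => (hder s).hasDerivWithinAt) ?_ (fun s => (hpow n s).const_mul C) ?_ ht
    · simp [Finset.sum_range_succ' _ (n + 1)]
    · intro s hs
      exact ih (fun k => a (k + 1)) (fun k hk s => ha (k + 1) (by omega) s) hC
        (Set.Ico_subset_Icc_self hs)

lemma update_const_zero {α : Type*} {n : ℕ} (v h : α) :
    (Function.update (fun _ => v) 0 h : Fin (n + 1) → α) = Fin.cons h fun _ => v := by
  ext j
  refine Fin.cases ?_ (fun j => ?_) j <;> simp

lemma update_const_succ {α : Type*} {n : ℕ} (v h : α) (i : Fin n) :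
    (Function.update (fun _ => v) i.succ h : Fin (n + 1) → α) =
      Fin.cons v (Function.update (fun _ => v) i h) := by
  ext j
  refine Fin.cases ?_ (fun j => ?_) j <;> simp [Function.update_apply, (Fin.succ_ne_zero i).symm]

/-- The iterated derivative of a `C^n` function, evaluated at a tuple with all entries but one
equal, does not depend on the position of the exceptional entry. -/
lemma ContDiff.iteratedFDeriv_update_const {n : ℕ} {f : E → ℝ} (hf : ContDiff ℝ (n + 1 : ℕ) f)
    (x v h : E) (i : Fin (n + 1)) :
    iteratedFDeriv ℝ (n + 1) f x (Function.update (fun _ => v) i h) =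
      iteratedFDeriv ℝ (n + 1) f x (Function.update (fun _ => v) 0 h) := by
  induction n generalizing x with
  | zero => rw [Fin.fin_one_eq_zero i]
  | succ n ih =>
    have hdiff : Differentiable ℝ (iteratedFDeriv ℝ (n + 1) f) :=
      hf.differentiable_iteratedFDeriv (by exact_mod_cast Nat.lt_succ_self _)
    refine Fin.cases rfl (fun j => ?_) i
    have hf' : ContDiff ℝ (n + 1 : ℕ) f := hf.of_le (by exact_mod_cast Nat.le_succ _)
    have hsymm : IsSymmSndFDerivAt ℝ (iteratedFDeriv ℝ n f) x := by
      refine ContDiffAt.isSymmSndFDerivAt (n := 2) (ContDiff.contDiffAt ?_) (by simp)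
      exact hf.iteratedFDeriv_right (by norm_cast; omega)
    have key : ∀ a b : E, iteratedFDeriv ℝ (n + 1 + 1) f x (Fin.cons a (Fin.cons b fun _ => v)) =
        fderiv ℝ (fderiv ℝ (iteratedFDeriv ℝ n f)) x a b (fun _ => v) := by
      intro a b
      rw [(hdiff x).iteratedFDeriv_succ_apply_left']
      simp only [Fin.tail_cons, Fin.cons_zero, iteratedFDeriv_succ_apply_left]
      have hd2 : DifferentiableAt ℝ (fderiv ℝ (iteratedFDeriv ℝ n f)) x := by
        have : ContDiff ℝ 2 (iteratedFDeriv ℝ n f) :=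
          hf.iteratedFDeriv_right (by norm_cast; omega)
        exact (this.fderiv_right (m := 1) (by norm_num)).differentiable (by norm_num) x
      have h1 : HasFDerivAt (fun y => fderiv ℝ (iteratedFDeriv ℝ n f) y b) _ x :=
        hd2.hasFDerivAt.clm_apply (hasFDerivAt_const b x)
      have h2 := (h1.continuousMultilinear_apply_const (fun _ => v))
      rw [h2.fderiv]
      simp
    calc iteratedFDeriv ℝ (n + 1 + 1) f x (Function.update (fun _ => v) j.succ h)
        = iteratedFDeriv ℝ (n + 1 + 1) f x
            (Fin.cons v (Function.update (fun _ => v) 0 h)) := by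
          rw [update_const_succ, (hdiff x).iteratedFDeriv_succ_apply_left',
            (hdiff x).iteratedFDeriv_succ_apply_left']
          simp only [Fin.tail_cons, Fin.cons_zero, ih hf' _ j]
      _ = iteratedFDeriv ℝ (n + 1 + 1) f x (Function.update (fun _ => v) 0 h) := by
          rw [update_const_zero, update_const_zero, key, hsymm.eq, ← key]
          congr 2
          ext j
          refine Fin.cases ?_ (fun j => ?_) j <;> simp

/-- The derivative of a homogeneous term of the Taylor polynomial. -/
lemma ContDiff.hasFDerivAt_iteratedFDeriv_const_sub {n : ℕ} {f : E → ℝ}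
    (hf : ContDiff ℝ (n + 1 : ℕ) f) (x y : E) :
    ∃ L : E →L[ℝ] ℝ,
      HasFDerivAt (fun z => iteratedFDeriv ℝ (n + 1) f x (fun _ => z - x)) L y ∧
      ∀ h, L h = (n + 1) * iteratedFDeriv ℝ (n + 1) f x
        (Function.update (fun _ => y - x) 0 h) := by
  refine ⟨_, ((iteratedFDeriv ℝ (n + 1) f x).hasFDerivAt (fun _ => y - x)).comp y
    (hasFDerivAt_pi.2 fun _ => (hasFDerivAt_id y).sub_const x), fun h => ?_⟩
  simp [ContinuousMultilinearMap.linearDeriv_apply, hf.iteratedFDeriv_update_const]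

lemma norm_apply_update_const_le {n : ℕ} (M : E [×(n + 1)]→L[ℝ] ℝ) (v h : E) :
    |M (Function.update (fun _ => v) 0 h)| ≤ ‖M‖ * (‖v‖ ^ n * ‖h‖) := by
  refine (M.le_opNorm _).trans_eq ?_
  simp [Fin.prod_univ_succ, mul_comm]

/-- Error bound for the derivative of the Taylor polynomial of a function whose highest
derivative is Hölder continuous. -/
lemma norm_fderiv_sub_fderiv_taylor_le {n : ℕ} {ν K : ℝ} (hν : 0 ≤ ν) (hK : 0 ≤ K)
    {f : E → ℝ} (hf : ContDiff ℝ (n + 1 : ℕ) f)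
    (hHolder : ∀ x y : E,
      ‖iteratedFDeriv ℝ (n + 1) f x - iteratedFDeriv ℝ (n + 1) f y‖ ≤ K * ‖x - y‖ ^ ν)
    (x y : E) :
    ∃ L : E →L[ℝ] ℝ, HasFDerivAt (fun z => f x + ∑ i ∈ Finset.Icc 1 (n + 1),
        (1 / (Nat.factorial i : ℝ)) * iteratedFDeriv ℝ i f x (fun _ => z - x)) L y ∧
      ‖fderiv ℝ f y - L‖ ≤ K / (n.factorial : ℝ) * (‖y - x‖ ^ ν * ‖y - x‖ ^ n) := by
  have hle : ∀ k ≤ n, ContDiff ℝ (k + 1 : ℕ) f := fun k hk =>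
    hf.of_le (by exact_mod_cast Nat.succ_le_succ hk)
  choose! L hL hLapp using fun k (hk : k ≤ n) =>
    (hle k hk).hasFDerivAt_iteratedFDeriv_const_sub x y
  refine ⟨∑ k ∈ Finset.range (n + 1), (1 / ((k + 1).factorial : ℝ)) • L k, ?_, ?_⟩
  · have hsum : ∀ g : ℕ → ℝ, ∑ i ∈ Finset.Icc 1 (n + 1), g i =
        ∑ k ∈ Finset.range (n + 1), g (k + 1) := fun g => by
      rw [← Finset.Ico_add_one_right_eq_Icc, Finset.sum_Ico_eq_sum_range]
      simp [add_comm]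
    simp only [hsum]
    refine HasFDerivAt.const_add _ (HasFDerivAt.fun_sum fun k hk => ?_)
    exact (hL k (by simpa [Nat.lt_succ_iff] using hk)).const_mul _
  · refine ContinuousLinearMap.opNorm_le_bound _ (by positivity) fun h => ?_
    set v := y - x with hv
    set a : ℕ → ℝ → ℝ := fun k t =>
      iteratedFDeriv ℝ (k + 1) f (x + t • v) (Function.update (fun _ => v) 0 h) with ha
    have hline : ∀ t : ℝ, HasDerivAt (fun t : ℝ => x + t • v) v t := fun t => by
      simpa using ((hasDerivAt_id t).smul_const v).const_add x
    have hder : ∀ k < n, ∀ t, HasDerivAt (a k) (a (k + 1) t) t := by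
      intro k hk t
      have hd : Differentiable ℝ (iteratedFDeriv ℝ (k + 1) f) :=
        hf.differentiable_iteratedFDeriv (by exact_mod_cast Nat.succ_lt_succ hk)
      have h1 := ((hd (x + t • v)).hasFDerivAt.continuousMultilinear_apply_const
        (Function.update (fun _ => v) 0 h)).comp_hasDerivAt t (hline t)
      refine h1.congr_deriv ?_
      simp only [ha]
      rw [← (hle (k + 1) hk).iteratedFDeriv_update_const _ _ _ (Fin.succ 0)]
      rw [update_const_succ, iteratedFDeriv_succ_apply_left]
      simp only [Fin.cons_zero, Fin.tail_cons]
      rfl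
    have hbound : ∀ t ∈ Set.Icc (0 : ℝ) 1,
        |a n t - a n 0| ≤ K * ‖v‖ ^ ν * (‖v‖ ^ n * ‖h‖) := by
      intro t ht
      have h1 := norm_apply_update_const_le
        (iteratedFDeriv ℝ (n + 1) f (x + t • v) - iteratedFDeriv ℝ (n + 1) f (x + (0 : ℝ) • v)) v h
      rw [sub_apply] at h1
      refine h1.trans ?_
      gcongr
      refine (hHolder _ _).trans ?_
      gcongr
      have : x + t • v - (x + (0 : ℝ) • v) = t • v := by simp
      rw [this, norm_smul, Real.norm_of_nonneg ht.1]
      exact mul_le_of_le_one_left (norm_nonneg _) ht.2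
    have key := abs_sub_taylor_sum_le n a hder hbound (Set.right_mem_Icc.2 zero_le_one)
    have h0 : a 0 1 = fderiv ℝ f y h := by
      simp [ha, hv]
    have h1 : (∑ k ∈ Finset.range (n + 1), (1 / ((k + 1).factorial : ℝ)) • L k) h =
        ∑ k ∈ Finset.range (n + 1), a k 0 * (1 ^ k / (k.factorial : ℝ)) := by
      rw [sum_apply]
      refine Finset.sum_congr rfl fun k hk => ?_
      rw [smul_apply, hLapp k (by simpa [Nat.lt_succ_iff] using hk),
        Nat.factorial_succ]
      have := Nat.factorial_ne_zero k
      simp only [ha, zero_smul, add_zero, one_pow, smul_eq_mul]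
      push_cast
      field_simp
    rw [sub_apply, h1, ← h0, Real.norm_eq_abs]
    refine key.trans_eq ?_
    rw [one_pow]
    ring

end Helpers

/-- Lemma 4.1. Composite version of Lemma 2.1: if
`‖∇f(x⁺) + g_φ(x⁺)‖ ≥ δ` and `‖∇Ω_{x,p,H}^{(ν)}(x⁺) + g_φ(x⁺)‖` is small enough, then
`‖∇Ω_{x,p,H}^{(ν)}(x⁺) + g_φ(x⁺)‖ ≤ θ‖x⁺ − x‖^{p+ν−1}`.  Here `φ : E → ℝ ∪ {+∞}` is a
proper closed convex function and `g_φ(x⁺)` is a subgradient of `φ` at `x⁺`. -/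
theorem statement_10
    {E : Type*} [NormedAddCommGroup E] [InnerProductSpace ℝ E] [FiniteDimensional ℝ E]
    (p : ℕ) (hp : 1 ≤ p) (ν Hf : ℝ) (hν : ν ∈ Set.Icc (0 : ℝ) 1)
    (hpν : 1 < (p : ℝ) + ν) (hHf : 0 < Hf)
    (f : E → ℝ) (hf : ContDiff ℝ p f)
    (hHolder : ∀ x y : E,
      ‖iteratedFDeriv ℝ p f x - iteratedFDeriv ℝ p f y‖ ≤ Hf * ‖x - y‖ ^ ν)
    (φ : E → EReal)
    (hφbot : ∀ z : E, φ z ≠ ⊥) (hφtop : ∃ z : E, φ z ≠ ⊤)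
    (hφclosed : LowerSemicontinuous φ)
    (hφconv : ∀ u v : E, ∀ a b : ℝ, 0 < a → 0 < b → a + b = 1 →
      φ (a • u + b • v) ≤ (a : EReal) * φ u + (b : EReal) * φ v)
    (x xp : E) (H θ δ : ℝ) (hH : 0 < H) (hθ : 0 < θ) (hδ : δ ∈ Set.Ioo (0 : ℝ) 1)
    (Ω : E → ℝ)
    (hΩ : Ω = fun y =>
      (f x + ∑ i ∈ Finset.Icc 1 p,
        (1 / (Nat.factorial i : ℝ)) * iteratedFDeriv ℝ i f x (fun _ => y - x))
      + (H / (Nat.factorial p : ℝ)) * ‖y - x‖ ^ ((p : ℝ) + ν))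
    (gφ : E)
    (hxp : φ xp ≠ ⊤)
    (hsub : ∀ z : E, φ xp + ((⟪gφ, z - xp⟫_ℝ : ℝ) : EReal) ≤ φ z)
    (h1 : δ ≤ ‖gradient f xp + gφ‖)
    (h2 : ‖gradient Ω xp + gφ‖ ≤
      min (1 / 2) (θ * (Nat.factorial (p - 1) : ℝ) / (2 * (Hf + H * ((p : ℝ) + ν)))) * δ) :
    ‖gradient Ω xp + gφ‖ ≤ θ * ‖xp - x‖ ^ ((p : ℝ) + ν - 1) := by
  obtain ⟨n, rfl⟩ : ∃ n, p = n + 1 := ⟨p - 1, by omega⟩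
  obtain ⟨L, hL, hLbound⟩ :=
    norm_fderiv_sub_fderiv_taylor_le hν.1 hHf.le hf hHolder x xp
  set q : ℝ := ((n + 1 : ℕ) : ℝ) + ν with hq
  set r := ‖xp - x‖ with hr
  have hN : HasFDerivAt (fun y => ‖y - x‖ ^ q)
      (fderiv ℝ (fun y => ‖y - x‖ ^ q) xp) xp :=
    (((differentiable_id.sub_const x).norm_rpow hpν) xp).hasFDerivAt
  have hNbound : ‖fderiv ℝ (fun y => ‖y - x‖ ^ q) xp‖ ≤ q * r ^ (q - 1) := by
    have h := norm_fderiv_norm_rpow_le (f := fun y : E => y - x)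
      (differentiable_id.sub_const x) (x := xp) hpν
    refine h.trans (mul_le_of_le_one_right (by positivity) ?_)
    rw [fderiv_sub_const]
    simpa using ContinuousLinearMap.norm_id_le
  have hΩd : HasFDerivAt Ω (L + (H / ((n + 1).factorial : ℝ)) •
      fderiv ℝ (fun y => ‖y - x‖ ^ q) xp) xp := by
    rw [hΩ]
    exact hL.add (hN.const_mul _)
  have hpow : r ^ ν * r ^ n = r ^ (q - 1) := by
    have hq1 : q - 1 = ν + n := by rw [hq]; push_cast; ring
    rw [hq1, Real.rpow_add_natCast' (norm_nonneg _)]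
    have : (0 : ℝ) < ν + n := by rw [← hq1]; linarith
    exact this.ne'
  have hn0 : (0 : ℝ) < n.factorial := by positivity
  have hgrad : ‖gradient f xp - gradient Ω xp‖ ≤
      (Hf + H * q) / (n.factorial : ℝ) * r ^ (q - 1) := by
    rw [← (InnerProductSpace.toDual ℝ E).norm_map, map_sub, toDual_gradient, toDual_gradient,
      hΩd.fderiv, ← sub_sub]
    refine (norm_sub_le _ _).trans ?_
    rw [norm_smul, Real.norm_of_nonneg (by positivity)]
    have hfac : H / ((n + 1).factorial : ℝ) ≤ H / (n.factorial : ℝ) := by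
      gcongr
      exact Nat.le_succ n
    have hmul := mul_le_mul hfac hNbound (norm_nonneg _) (by positivity)
    rw [hpow] at hLbound
    calc _ ≤ Hf / (n.factorial : ℝ) * r ^ (q - 1) +
          H / (n.factorial : ℝ) * (q * r ^ (q - 1)) := add_le_add hLbound hmul
      _ = _ := by ring
  rw [Nat.add_sub_cancel] at h2
  have hδ0 := hδ.1
  set w := ‖gradient Ω xp + gφ‖ with hw
  have hC : 0 < Hf + H * q := by positivity
  have hhalf : w ≤ 1 / 2 * δ := h2.trans (by gcongr; exact min_le_left _ _)
  have hθδ : w ≤ θ * (n.factorial : ℝ) / (2 * (Hf + H * q)) * δ :=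
    h2.trans (by gcongr; exact min_le_right _ _)
  have htri : ‖gradient f xp + gφ‖ ≤ ‖gradient f xp - gradient Ω xp‖ + w := by
    refine le_trans (le_of_eq ?_) (norm_add_le _ _)
    congr 1
    abel
  have hδr : δ ≤ 2 * ((Hf + H * q) / (n.factorial : ℝ) * r ^ (q - 1)) := by linarith
  calc w ≤ θ * (n.factorial : ℝ) / (2 * (Hf + H * q)) * δ := hθδ
    _ ≤ θ * (n.factorial : ℝ) / (2 * (Hf + H * q)) *
        (2 * ((Hf + H * q) / (n.factorial : ℝ) * r ^ (q - 1))) := by gcongr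
    _ = θ * r ^ (q - 1) := by field_simp
end
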